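/- Let N¹ and N² be counting processes adapted to a filtration, each starting at 0, right continuous with left limits, piecewise constant with jumps of size one, such that N^j_t − λ_j t is a martingale (λ_j > 0) and N¹ and N² have no jumps in common (their jump times are a.s. disjoint). Then for every t₀ > 0 and every u₁, u₂ ∈ ℝ, E[e^{iu₁N¹_{t₀}} e^{iu₂N²_{t₀}}] = e^{λ₁t₀(e^{iu₁}−1)} e^{λ₂t₀(e^{iu₂}−1)}; in particular N¹_{t₀} and N²_{t₀} are independent Poisson random variables with means λ₁t₀ and λ₂t₀. -/

import Mathlib

open MeasureTheory ProbabilityTheory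
open scoped NNReal
section
open Filter Topology


lemma path_aux (a b : ℝ≥0 → ℝ) (ha : Monotone a) (hb : Monotone b)
    (hra : ∀ t, ContinuousWithinAt a (Set.Ici t) t)
    (hrb : ∀ t, ContinuousWithinAt b (Set.Ici t) t)
    (hja : ∀ t, 0 < t → a t - Function.leftLim a t ≤ 1)
    (hjb : ∀ t, 0 < t → b t - Function.leftLim b t ≤ 1)
    (hno : ∀ t, 0 < t → ¬ (Function.leftLim a t ≠ a t ∧ Function.leftLim b t ≠ b t))
    (t : ℝ≥0) :
    ∀ᶠ n : ℕ in atTop, ∀ k < n,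
      (a ((k + 1 : ℕ) * (t / n)) + b ((k + 1 : ℕ) * (t / n))) -
        (a (k * (t / n)) + b (k * (t / n))) < 2 := by
  have loc : ∀ s : ℝ≥0, ∃ U : Set ℝ≥0, IsOpen U ∧ s ∈ U ∧
      ∀ x ∈ U, ∀ y ∈ U, (a y + b y) - (a x + b x) < 2 := by
    intro s
    have hJ : (a s + b s) - (Function.leftLim a s + Function.leftLim b s) ≤ 1 := by
      rcases eq_or_lt_of_le (zero_le : 0 ≤ s) with h | h
      · subst h
        rw [leftLim_eq_of_isBot (f := a) (fun x => zero_le), leftLim_eq_of_isBot (f := b) (fun x => zero_le)]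
        simp
      · have h1 := hja s h
        have h2 := hjb s h
        have h3 := hno s h
        by_cases h4 : Function.leftLim a s = a s
        · linarith
        · by_cases h5 : Function.leftLim b s = b s
          · linarith
          · exact absurd ⟨h4, h5⟩ h3
    have e1 : ∀ᶠ y in 𝓝[≥] s, a y + b y < a s + b s + 1/2 :=
      ((hra s).add (hrb s)).eventually (gt_mem_nhds (by simp))
    have e2 : ∀ᶠ x in 𝓝[<] s, Function.leftLim a s + Function.leftLim b s - 1/2 < a x + b x :=
      ((ha.tendsto_leftLim s).add (hb.tendsto_leftLim s)).eventually (lt_mem_nhds (by linarith))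
    have la := ha.leftLim_le (le_refl s)
    have lb := hb.leftLim_le (le_refl s)
    have e : ∀ᶠ y in 𝓝 s, a y + b y < a s + b s + 1/2 ∧
        Function.leftLim a s + Function.leftLim b s - 1/2 < a y + b y := by
      rw [eventually_nhdsWithin_iff] at e1 e2
      filter_upwards [e1, e2] with y h1 h2
      rcases lt_or_ge y s with h | h
      · exact ⟨by linarith [ha h.le, hb h.le], h2 h⟩
      · exact ⟨h1 h, by linarith [ha h, hb h]⟩
    obtain ⟨U, hU, hUo, hs⟩ := eventually_nhds_iff.1 e
    exact ⟨U, hUo, hs, fun x hx y hy => by linarith [(hU x hx).2, (hU y hy).1]⟩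
  choose U hUo hUs hU using loc
  obtain ⟨δ, hδ, hL⟩ := lebesgue_number_lemma_of_metric (isCompact_Icc (a := (0:ℝ≥0)) (b := t))
    hUo (fun x _ => Set.mem_iUnion.2 ⟨x, hUs x⟩)
  have hlim : Tendsto (fun n : ℕ => (t : ℝ) / n) atTop (𝓝 0) := tendsto_const_div_atTop_nhds_zero_nat _
  filter_upwards [hlim.eventually (gt_mem_nhds hδ), eventually_gt_atTop 0] with n hn hn0 k hk
  have hmem : (k : ℝ≥0) * (t / n) ∈ Set.Icc (0:ℝ≥0) t := by
    refine ⟨zero_le, ?_⟩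
    have : (0:ℝ≥0) < n := by exact_mod_cast hn0
    rw [← mul_div_assoc, div_le_iff₀ this, mul_comm]
    gcongr
  obtain ⟨i, hi⟩ := hL _ hmem
  refine hU i _ (hi (Metric.mem_ball_self hδ)) _ (hi ?_)
  rw [Metric.mem_ball, NNReal.dist_eq]
  push_cast
  rw [show ((k:ℝ) + 1) * (t / n) - k * (t / n) = t / n by ring, abs_of_nonneg (by positivity)]
  exact hn

lemma rec_aux (f e : ℕ → ℂ) (q : ℂ) (r : ℝ) (hq : ‖q‖ ≤ r) (hr : 1 ≤ r) (h0 : f 0 = 1)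
    (m : ℕ) (h : ∀ k < m, f (k + 1) = q * f k + e k) :
    ‖f m - q ^ m‖ ≤ r ^ m * ∑ k ∈ Finset.range m, ‖e k‖ := by
  induction m with
  | zero => simp [h0]
  | succ m ih =>
    have ih := ih (fun k hk => h k (by omega))
    rw [h m (by omega), Finset.sum_range_succ,
      show q * f m + e m - q ^ (m + 1) = q * (f m - q ^ m) + e m by ring]
    calc _ ≤ ‖q‖ * ‖f m - q ^ m‖ + ‖e m‖ := by
          refine (norm_add_le _ _).trans ?_
          rw [norm_mul]
      _ ≤ r * (r ^ m * ∑ k ∈ Finset.range m, ‖e k‖) + r ^ (m + 1) * ‖e m‖ := by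
          gcongr
          exact le_mul_of_one_le_left (norm_nonneg _) (one_le_pow₀ hr)
      _ = _ := by ring

lemma mart_aux {Ω : Type*} {m0 : MeasurableSpace Ω} (μ : Measure Ω)
    [IsProbabilityMeasure μ] (ℱ : Filtration ℝ≥0 m0) (M : ℝ≥0 → Ω → ℝ)
    (hM : Martingale M ℱ μ) (s t : ℝ≥0) (hst : s ≤ t) (g : Ω → ℂ)
    (hg : StronglyMeasurable[ℱ s] g) (hb : ∀ ω, ‖g ω‖ ≤ 1) :
    ∫ ω, g ω * ((M t ω - M s ω : ℝ) : ℂ) ∂μ = 0 := by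
  let B : ℂ →L[ℝ] ℝ →L[ℝ] ℂ := (ContinuousLinearMap.lsmul ℝ ℝ).flip
  have hI : Integrable (fun ω => M t ω - M s ω) μ := (hM.integrable t).sub (hM.integrable s)
  have hB : ∀ ω, B (g ω) (M t ω - M s ω) = g ω * ((M t ω - M s ω : ℝ) : ℂ) := by
    intro ω
    simp [B, mul_comm]
  have hgI : Integrable (fun ω => B (g ω) (M t ω - M s ω)) μ := by
    simp_rw [hB]
    exact hI.ofReal.bdd_mul (c := 1) ((hg.mono (ℱ.le s)).aestronglyMeasurable) (ae_of_all _ hb)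
  have h1 := condExp_bilin_of_stronglyMeasurable_left (μ := μ) B hg hgI hI
  have h2 : μ[fun ω => M t ω - M s ω | ℱ s] =ᵐ[μ] 0 := by
    have := condExp_sub (hM.integrable t) (hM.integrable s) (ℱ s)
    refine EventuallyEq.trans this ?_
    filter_upwards [hM.2 s t hst, hM.2 s s le_rfl] with ω h3 h4
    simp [h3, h4]
  simp_rw [← hB]
  rw [← integral_condExp (ℱ.le s), integral_congr_ae (g := fun _ => 0)]
  · simp
  · filter_upwards [h1, h2] with ω h3 h4
    rw [h3, h4]; simp

lemma exp_aux (u₁ u₂ : ℝ) (x y : ℕ) :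
    ‖Complex.exp (u₁ * x * Complex.I) * Complex.exp (u₂ * y * Complex.I) - 1
      - (Complex.exp (u₁ * Complex.I) - 1) * x - (Complex.exp (u₂ * Complex.I) - 1) * y‖
      ≤ if x + y < 2 then 0 else 4 * ((x : ℝ) + y) := by
  split_ifs with h
  · have : (x = 0 ∧ y = 0) ∨ (x = 1 ∧ y = 0) ∨ (x = 0 ∧ y = 1) := by omega
    rcases this with ⟨rfl, rfl⟩ | ⟨rfl, rfl⟩ | ⟨rfl, rfl⟩ <;> simp
  · have n1 : ∀ r : ℝ, ‖Complex.exp (r * Complex.I)‖ = 1 := Complex.norm_exp_ofReal_mul_I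
    have n2 : ∀ r : ℝ, ‖Complex.exp (r * Complex.I) - 1‖ ≤ 2 := fun r => by
      refine (norm_sub_le _ _).trans ?_
      rw [n1]; norm_num
    have e1 := n1 (u₁ * x)
    have e2 := n1 (u₂ * y)
    push_cast at e1 e2
    have h2 : (2 : ℝ) ≤ x + y := by exact_mod_cast not_lt.1 h
    refine (norm_sub_le _ _).trans ?_
    refine (add_le_add_left (norm_sub_le _ _) _).trans ?_
    refine (add_le_add_left (add_le_add_left (norm_sub_le _ _) _) _).trans ?_
    simp only [norm_mul, e1, e2, Complex.norm_natCast, norm_one]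
    have := mul_le_mul_of_nonneg_right (n2 u₁) (Nat.cast_nonneg (α := ℝ) x)
    have := mul_le_mul_of_nonneg_right (n2 u₂) (Nat.cast_nonneg (α := ℝ) y)
    linarith

lemma sm_aux {Ω : Type*} {m : MeasurableSpace Ω} {f g : Ω → ℝ} (hf : StronglyMeasurable f)
    (hg : StronglyMeasurable g) (u₁ u₂ : ℝ) :
    StronglyMeasurable (fun ω => Complex.exp (u₁ * f ω * Complex.I) *
          Complex.exp (u₂ * g ω * Complex.I)) := by
  have hf := hf.measurable
  have hg := hg.measurable
  exact Measurable.stronglyMeasurable (by fun_prop)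

set_option maxHeartbeats 1000000 in
lemma char_aux {Ω : Type*} {m0 : MeasurableSpace Ω} (μ : Measure Ω)
    [IsProbabilityMeasure μ] (ℱ : MeasureTheory.Filtration ℝ≥0 m0)
    (N : Fin 2 → ℝ≥0 → Ω → ℝ) (lam : Fin 2 → ℝ)
    (hzero : ∀ j ω, N j 0 ω = 0)
    (hmono : ∀ j ω, Monotone (fun t => N j t ω))
    (hrc : ∀ j ω t, ContinuousWithinAt (fun s => N j s ω) (Set.Ici t) t)
    (hnat : ∀ j ω t, ∃ n : ℕ, N j t ω = n)
    (hjump : ∀ j ω (t : ℝ≥0), 0 < t →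
      N j t ω - Function.leftLim (fun s => N j s ω) t ≤ 1)
    (hmart : ∀ j, Martingale (fun t ω => N j t ω - lam j * t) ℱ μ)
    (hnocommon : ∀ ω (t : ℝ≥0), 0 < t →
      ¬(Function.leftLim (fun s => N 0 s ω) t ≠ N 0 t ω ∧
        Function.leftLim (fun s => N 1 s ω) t ≠ N 1 t ω))
    (t : ℝ≥0) (u₁ u₂ : ℝ) :
      ∫ ω, Complex.exp (u₁ * N 0 t ω * Complex.I) *
          Complex.exp (u₂ * N 1 t ω * Complex.I) ∂μ
        = Complex.exp (((lam 0 * (t : ℝ)) * (Complex.exp (u₁ * Complex.I) - 1)) +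
          ((lam 1 * (t : ℝ)) * (Complex.exp (u₂ * Complex.I) - 1))) := by
  have hsm : ∀ j s, StronglyMeasurable[ℱ s] (N j s) := fun j s => by
    have := ((hmart j).stronglyMeasurable s).add (stronglyMeasurable_const (b := lam j * s))
    have e : N j s = (fun ω => N j s ω - lam j * s) + fun _ => lam j * (s : ℝ) := by
      ext ω; simp
    rw [e]; exact this
  have hint : ∀ j s, Integrable (N j s) μ := fun j s => by
    have := ((hmart j).integrable s).add (integrable_const (lam j * s))
    refine this.congr (ae_of_all _ fun ω => ?_)
    simp
  set Z : ℝ≥0 → Ω → ℂ := fun s ω => Complex.exp (u₁ * N 0 s ω * Complex.I) *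
          Complex.exp (u₂ * N 1 s ω * Complex.I) with hZ
  have hZm : ∀ s, StronglyMeasurable[ℱ s] (Z s) := fun s => by
    exact sm_aux (hsm 0 s) (hsm 1 s) u₁ u₂
  have hZn : ∀ s ω, ‖Z s ω‖ = 1 := fun s ω => by
    have e1 := Complex.norm_exp_ofReal_mul_I (u₁ * N 0 s ω)
    have e2 := Complex.norm_exp_ofReal_mul_I (u₂ * N 1 s ω)
    push_cast at e1 e2
    simp only [hZ, norm_mul, e1, e2, mul_one]
  have hZa : ∀ s, AEStronglyMeasurable (Z s) μ := fun s =>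
    ((hZm s).mono (ℱ.le s)).aestronglyMeasurable
  have hZi : ∀ s, Integrable (Z s) μ := fun s =>
    (integrable_const (1:ℝ)).mono' (hZa s) (ae_of_all _ fun ω => (hZn s ω).le)
  set a₁ : ℂ := Complex.exp (u₁ * Complex.I) - 1 with ha₁
  set a₂ : ℂ := Complex.exp (u₂ * Complex.I) - 1 with ha₂
  set c : ℂ := lam 0 * a₁ + lam 1 * a₂ with hc
  -- the remainder
  let D : ℝ≥0 → ℝ≥0 → Ω → ℂ := fun s r ω => Z r ω - Z s ω
    - a₁ * (Z s ω * ((N 0 r ω - N 0 s ω : ℝ) : ℂ)) - a₂ * (Z s ω * ((N 1 r ω - N 1 s ω : ℝ) : ℂ))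
  have hZNi : ∀ j s r, Integrable (fun ω => Z s ω * ((N j r ω - N j s ω : ℝ) : ℂ)) μ := fun j s r =>
    (((hint j r).sub (hint j s)).ofReal).bdd_mul (c := 1) (hZa s) (ae_of_all _ fun ω => (hZn s ω).le)
  have hDi : ∀ s r, Integrable (D s r) μ := fun s r =>
    (((hZi r).sub (hZi s)).sub ((hZNi 0 s r).const_mul a₁)).sub ((hZNi 1 s r).const_mul a₂)
  have hEN : ∀ j s r, s ≤ r → ∫ ω, Z s ω * ((N j r ω - N j s ω : ℝ) : ℂ) ∂μ
      = (lam j * ((r:ℝ) - s) : ℂ) * ∫ ω, Z s ω ∂μ := by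
    intro j s r hsr
    have h1 := mart_aux μ ℱ _ (hmart j) s r hsr (Z s) (hZm s) (fun ω => (hZn s ω).le)
    have h2 : ∀ ω, Z s ω * (((N j r ω - lam j * r) - (N j s ω - lam j * s) : ℝ) : ℂ)
        = Z s ω * ((N j r ω - N j s ω : ℝ) : ℂ) - (lam j * ((r:ℝ) - s) : ℂ) * Z s ω := by
      intro ω; push_cast; ring
    simp_rw [h2] at h1
    rw [integral_sub (hZNi j s r) ((hZi s).const_mul _), integral_const_mul, sub_eq_zero] at h1
    exact h1
  have hrec : ∀ s r, s ≤ r → ∫ ω, Z r ω ∂μ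
      = (1 + c * ((r:ℝ) - s)) * ∫ ω, Z s ω ∂μ + ∫ ω, D s r ω ∂μ := by
    intro s r hsr
    have : ∫ ω, D s r ω ∂μ = ∫ ω, Z r ω ∂μ - ∫ ω, Z s ω ∂μ
      - a₁ * ((lam 0 * ((r:ℝ) - s) : ℂ) * ∫ ω, Z s ω ∂μ)
      - a₂ * ((lam 1 * ((r:ℝ) - s) : ℂ) * ∫ ω, Z s ω ∂μ) := by
      rw [← hEN 0 s r hsr, ← hEN 1 s r hsr, ← integral_const_mul, ← integral_const_mul,
        ← integral_sub (hZi r) (hZi s), ← integral_sub, ← integral_sub]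
      · exact ((hZi r).sub (hZi s)).sub ((hZNi 0 s r).const_mul a₁)
      · exact (hZNi 1 s r).const_mul a₂
      · exact (hZi r).sub (hZi s)
      · exact (hZNi 0 s r).const_mul a₁
    rw [this, hc]; ring
  -- pointwise bound of remainder
  have hDb : ∀ s r, s ≤ r → ∀ ω, ‖D s r ω‖ ≤
      if (N 0 r ω + N 1 r ω) - (N 0 s ω + N 1 s ω) < 2 then 0 else
        4 * ((N 0 r ω + N 1 r ω) - (N 0 s ω + N 1 s ω)) := by
    intro s r hsr ω
    have hd : ∀ j, ∃ x : ℕ, N j r ω = N j s ω + x := fun j => by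
      obtain ⟨x, hx⟩ := hnat j ω r
      obtain ⟨y, hy⟩ := hnat j ω s
      have h := hmono j ω hsr
      simp only [hx, hy] at h
      have h' : y ≤ x := by exact_mod_cast h
      refine ⟨x - y, ?_⟩
      rw [hx, hy]; push_cast [h']; ring
    obtain ⟨x, hx⟩ := hd 0
    obtain ⟨y, hy⟩ := hd 1
    have hE := exp_aux u₁ u₂ x y
    have hD : D s r ω = Z s ω * (Complex.exp (u₁ * x * Complex.I) * Complex.exp (u₂ * y * Complex.I) - 1
      - a₁ * x - a₂ * y) := by
      have : Z r ω = Z s ω * (Complex.exp (u₁ * x * Complex.I) * Complex.exp (u₂ * y * Complex.I)) := by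
        simp only [hZ, hx, hy, ← Complex.exp_add]
        congr 1; push_cast; ring
      simp only [D, this, hx, hy]; push_cast; ring
    rw [hD, norm_mul, hZn, one_mul]
    refine hE.trans (le_of_eq ?_)
    have e : (N 0 r ω + N 1 r ω) - (N 0 s ω + N 1 s ω) = (x:ℝ) + y := by rw [hx, hy]; ring
    rw [e]
    have : ((x:ℝ) + y < 2) ↔ x + y < 2 := by exact_mod_cast Iff.rfl
    simp only [this]
  let p : ℕ → ℕ → ℝ≥0 := fun n k => k * (t / n)
  have hp : ∀ n k, p n k ≤ p n (k + 1) := fun n k => by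
    simp only [p]; gcongr; simp
  have hpn : ∀ n, 0 < n → p n n = t := fun n hn => by
    have : (n : ℝ≥0) ≠ 0 := by exact_mod_cast hn.ne'
    simp only [p]; field_simp
  have hnn : ∀ j ω s, 0 ≤ N j s ω := fun j ω s => by
    obtain ⟨x, hx⟩ := hnat j ω s
    rw [hx]; positivity
  -- total error tends to zero
  have hlim : Tendsto (fun n : ℕ => ∫ ω, ∑ k ∈ Finset.range n, ‖D (p n k) (p n (k+1)) ω‖ ∂μ)
      atTop (𝓝 0) := by
    rw [show (0:ℝ) = ∫ ω, (0:ℝ) ∂μ by simp]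
    refine tendsto_integral_filter_of_dominated_convergence (fun ω => 4 * (N 0 t ω + N 1 t ω)) ?_ ?_ ?_ ?_
    · exact Eventually.of_forall fun n =>
        (integrable_finsetSum _ fun k _ => (hDi _ _).norm).aestronglyMeasurable
    · filter_upwards [eventually_gt_atTop 0] with n hn
      refine ae_of_all _ fun ω => ?_
      rw [Real.norm_of_nonneg (Finset.sum_nonneg fun _ _ => norm_nonneg _)]
      calc _ ≤ ∑ k ∈ Finset.range n, (4 * (N 0 (p n (k+1)) ω + N 1 (p n (k+1)) ω)
              - 4 * (N 0 (p n k) ω + N 1 (p n k) ω)) := by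
            refine Finset.sum_le_sum fun k _ => (hDb _ _ (hp n k) ω).trans ?_
            have h0 := hmono 0 ω (hp n k)
            have h1 := hmono 1 ω (hp n k)
            simp only at h0 h1
            split_ifs <;> linarith
        _ = _ := by
            rw [Finset.sum_range_sub (fun k => 4 * (N 0 (p n k) ω + N 1 (p n k) ω)), hpn n hn]
            simp [p, hzero]
    · exact ((hint 0 t).add (hint 1 t)).const_mul 4
    · refine ae_of_all _ fun ω => ?_
      have := path_aux (fun s => N 0 s ω) (fun s => N 1 s ω) (hmono 0 ω) (hmono 1 ω)
        (hrc 0 ω) (hrc 1 ω) (hjump 0 ω) (hjump 1 ω) (hnocommon ω) t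
      refine tendsto_const_nhds.congr' ?_
      filter_upwards [this] with n hn
      symm
      refine Finset.sum_eq_zero fun k hk => le_antisymm ?_ (norm_nonneg _)
      refine (hDb _ _ (hp n k) ω).trans ?_
      rw [if_pos (hn k (Finset.mem_range.1 hk))]
  have hf0 : ∫ ω, Z 0 ω ∂μ = 1 := by simp [hZ, hzero]
  have hbound : ∀ n : ℕ, 0 < n → ‖∫ ω, Z t ω ∂μ - (1 + (c * t) / n) ^ n‖ ≤
      Real.exp (‖c‖ * t) * ∫ ω, ∑ k ∈ Finset.range n, ‖D (p n k) (p n (k+1)) ω‖ ∂μ := by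
    intro n hn
    have hn' : (n:ℝ) ≠ 0 := by exact_mod_cast hn.ne'
    have hr := rec_aux (fun k => ∫ ω, Z (p n k) ω ∂μ) (fun k => ∫ ω, D (p n k) (p n (k+1)) ω ∂μ)
      (1 + (c * t) / n) (1 + ‖c‖ * t / n) (by
        refine (norm_add_le _ _).trans ?_
        simp) (by simp; positivity) (by simp [p, hf0]) n (by
        intro k _
        rw [hrec _ _ (hp n k)]
        congr 3
        simp only [p]; push_cast; ring)
    simp only [hpn n hn] at hr
    refine hr.trans ?_
    have h1 : (1 + ‖c‖ * t / n) ^ n ≤ Real.exp (‖c‖ * t) := by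
      calc _ ≤ (Real.exp (‖c‖ * t / n)) ^ n := by
            gcongr
            rw [add_comm]; exact Real.add_one_le_exp _
        _ = _ := by rw [← Real.exp_nat_mul]; congr 1; field_simp
    rw [integral_finsetSum _ fun k _ => (hDi _ _).norm]
    gcongr
    exact norm_integral_le_integral_norm _
  have hT := Complex.tendsto_one_add_div_pow_exp (c * t)
  have hT2 : Tendsto (fun n : ℕ => (1 + (c * t) / n) ^ n) atTop (𝓝 (∫ ω, Z t ω ∂μ)) := by
    rw [tendsto_iff_norm_sub_tendsto_zero]
    refine squeeze_zero' (Eventually.of_forall fun _ => norm_nonneg _) ?_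
      (by simpa using hlim.const_mul (Real.exp (‖c‖ * t)))
    filter_upwards [eventually_gt_atTop 0] with n hn
    rw [norm_sub_rev]
    exact hbound n hn
  rw [tendsto_nhds_unique hT2 hT, hc]
  congr 1
  push_cast; ring

end

/-- Watanabe-type characterization (key step of Proposition A.1): if `N¹, N²` are
counting processes starting at 0 (right continuous, nondecreasing, integer valued,
with jumps of size one) such that `N^j_t − λ_j t` is a martingale and `N¹, N²`
have no jumps in common, then
`E[e^{iu₁N¹_{t₀}}e^{iu₂N²_{t₀}}] = e^{λ₁t₀(e^{iu₁}−1)}e^{λ₂t₀(e^{iu₂}−1)}`;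
in particular `N¹_{t₀}` and `N²_{t₀}` are independent Poisson random variables
with means `λ₁t₀` and `λ₂t₀`. -/
theorem stmt14 {Ω : Type*} {m0 : MeasurableSpace Ω} (μ : Measure Ω)
    [IsProbabilityMeasure μ] (ℱ : MeasureTheory.Filtration ℝ≥0 m0)
    (N : Fin 2 → ℝ≥0 → Ω → ℝ) (lam : Fin 2 → ℝ) (hlam : ∀ j, 0 < lam j)
    (hzero : ∀ j ω, N j 0 ω = 0)
    (hmono : ∀ j ω, Monotone (fun t => N j t ω))
    (hrc : ∀ j ω t, ContinuousWithinAt (fun s => N j s ω) (Set.Ici t) t)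
    (hnat : ∀ j ω t, ∃ n : ℕ, N j t ω = n)
    (hjump : ∀ j ω (t : ℝ≥0), 0 < t →
      N j t ω - Function.leftLim (fun s => N j s ω) t ≤ 1)
    (hmart : ∀ j, Martingale (fun t ω => N j t ω - lam j * t) ℱ μ)
    (hnocommon : ∀ ω (t : ℝ≥0), 0 < t →
      ¬(Function.leftLim (fun s => N 0 s ω) t ≠ N 0 t ω ∧
        Function.leftLim (fun s => N 1 s ω) t ≠ N 1 t ω)) :
    ∀ (t₀ : ℝ≥0), 0 < t₀ → ∀ u₁ u₂ : ℝ,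
      (∫ ω, Complex.exp (u₁ * N 0 t₀ ω * Complex.I) *
          Complex.exp (u₂ * N 1 t₀ ω * Complex.I) ∂μ
        = Complex.exp ((lam 0 * (t₀ : ℝ)) * (Complex.exp (u₁ * Complex.I) - 1)) *
          Complex.exp ((lam 1 * (t₀ : ℝ)) * (Complex.exp (u₂ * Complex.I) - 1))) ∧
      IndepFun (fun ω => N 0 t₀ ω) (fun ω => N 1 t₀ ω) μ ∧
      ∀ (j : Fin 2) (n : ℕ),
        μ {ω | N j t₀ ω = n} =
          ENNReal.ofReal
            (Real.exp (-(lam j * (t₀ : ℝ))) * (lam j * (t₀ : ℝ)) ^ n / n.factorial) := by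
  have hchar := char_aux μ ℱ N lam hzero hmono hrc hnat hjump hmart hnocommon
  intro t₀ ht₀ u₁ u₂
  have hm : ∀ j, Measurable (N j t₀) := fun j => by
    have := (((hmart j).stronglyMeasurable t₀).mono (ℱ.le t₀)).measurable.add_const (lam j * t₀)
    simpa using this
  let r : Fin 2 → ℝ≥0 := fun j => ⟨lam j * t₀, mul_nonneg (hlam j).le t₀.2⟩
  have hcf : ∀ j u, charFun (μ.map (N j t₀)) u
      = Complex.exp ((lam j * (t₀:ℝ)) * (Complex.exp (u * Complex.I) - 1)) := by
    intro j u
    rw [charFun_apply_real, integral_map (hm j).aemeasurable (by fun_prop)]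
    fin_cases j
    · have := hchar t₀ u 0
      simpa using this
    · have := hchar t₀ 0 u
      simpa using this
  refine ⟨by rw [hchar, Complex.exp_add], ?_, ?_⟩
  · rw [indepFun_iff_charFun_prod (hm 0).aemeasurable (hm 1).aemeasurable]
    intro v
    rw [hcf, hcf, ← Complex.exp_add, ← hchar, charFun_apply, integral_map (by fun_prop) (by fun_prop)]
    refine integral_congr_ae (ae_of_all _ fun ω => ?_)
    simp only [WithLp.prod_inner_apply, ← Complex.exp_add]
    congr 1
    simp
    ring
  · intro j n
    have hlaw : μ.map (N j t₀) = (poissonMeasure (r j)).map (Nat.cast : ℕ → ℝ) := by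
      have := Measure.isProbabilityMeasure_map (μ := μ) (hm j).aemeasurable
      have : IsProbabilityMeasure ((poissonMeasure (r j)).map (Nat.cast : ℕ → ℝ)) :=
        Measure.isProbabilityMeasure_map (by fun_prop)
      apply Measure.ext_of_charFun
      ext u
      rw [hcf, charFun_map_cast_poissonMeasure]
      have hrj : ((r j : ℝ≥0) : ℝ) = lam j * t₀ := rfl
      rw [hrj]; push_cast; rfl
    have h1 : μ {ω | N j t₀ ω = n} = μ.map (N j t₀) {(n:ℝ)} := by
      rw [Measure.map_apply (hm j) (measurableSet_singleton _)]; rfl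
    rw [h1, hlaw, Measure.map_apply (by fun_prop) (measurableSet_singleton _)]
    have : (Nat.cast : ℕ → ℝ) ⁻¹' {(n:ℝ)} = {n} := by ext; simp
    rw [this, poissonMeasure_singleton]
    rfl
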